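/- (Soundness of OUTDICLIQUE) Let G be a digraph and v ∈ V(G) a vertex with (v,v) ∉ E(G) such that the set of successors N_succ(v) forms a diclique in G. Then DFVS(G) = DFVS(G∘v), and every DFVS of G∘v is a DFVS of G. -/

import Mathlib

namespace DFVSP

open scoped Classical

noncomputable section

variable {V : Type*} [Fintype V] [DecidableEq V]

/-- A digraph on the (finite) vertex set `V` is given by its finite set of arcs. -/
abbrev Dgraph (V : Type*) := Finset (V × V)

/-- `p` is a path in `G`: a list of vertices where consecutive vertices are joined by arcs. -/
def IsPath (G : Dgraph V) (p : List V) : Prop :=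
  List.Chain' (fun a b => (a, b) ∈ G) p

/-- `p` is a path in `G` that starts at `a` and ends at `b`. -/
def IsPathFrom (G : Dgraph V) (a b : V) (p : List V) : Prop :=
  IsPath G p ∧ p.head? = some a ∧ p.getLast? = some b

/-- `p` is a cycle in `G`: a path `v₁,…,vₙ` with `n ≥ 2` and `v₁ = vₙ`. -/
def IsCycle (G : Dgraph V) (p : List V) : Prop :=
  IsPath G p ∧ 2 ≤ p.length ∧ p.head? = p.getLast?

/-- `D` is a directed feedback vertex set of `G`: every cycle contains a vertex of `D`. -/
def IsDFVS (G : Dgraph V) (D : Finset V) : Prop :=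
  ∀ p : List V, IsCycle G p → ∃ x ∈ p, x ∈ D

/-- The minimum cardinality of a DFVS of `G`. -/
def dfvsNum (G : Dgraph V) : ℕ :=
  sInf {n | ∃ D : Finset V, IsDFVS G D ∧ D.card = n}

/-- `D` is a DFVS of `G` of minimum cardinality. -/
def IsMinDFVS (G : Dgraph V) (D : Finset V) : Prop :=
  IsDFVS G D ∧ ∀ D' : Finset V, IsDFVS G D' → D.card ≤ D'.card

/-- The predecessors of `v` in `G`. -/
def Npre (G : Dgraph V) (v : V) : Finset V := Finset.univ.filter fun p => (p, v) ∈ G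

/-- The successors of `v` in `G`. -/
def Nsucc (G : Dgraph V) (v : V) : Finset V := Finset.univ.filter fun s => (v, s) ∈ G

/-- The bi-edge neighbours of `v` in `G`. -/
def Nbi (G : Dgraph V) (v : V) : Finset V := Npre G v ∩ Nsucc G v

/-- The neighbours of `v` in `G`. -/
def Nbhd (G : Dgraph V) (v : V) : Finset V := Npre G v ∪ Nsucc G v

/-- The consecutive pairs of vertices along a list. -/
def consecutivePairs (p : List V) : List (V × V) := p.zip p.tail

/-- The path `p` uses a bi-edge of `G`. -/
def UsesBiEdge (G : Dgraph V) (p : List V) : Prop :=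
  ∃ q ∈ consecutivePairs p, (q.1, q.2) ∈ G ∧ (q.2, q.1) ∈ G

/-- A path (or cycle) `p` is uncovered in `G` if there is no cycle whose vertex set is a
proper subset of the vertex set of `p`. -/
def Uncovered (G : Dgraph V) (p : List V) : Prop :=
  ¬ ∃ q : List V, IsCycle G q ∧ q.toFinset ⊂ p.toFinset

/-- `G − v`: delete the vertex `v` together with all incident arcs. -/
def deleteVertex (G : Dgraph V) (v : V) : Dgraph V :=
  G.filter fun a => a.1 ≠ v ∧ a.2 ≠ v

/-- `G[A]`: the subdigraph induced by the vertex set `A`. -/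
def induce (G : Dgraph V) (A : Finset V) : Dgraph V :=
  G.filter fun a => a.1 ∈ A ∧ a.2 ∈ A

/-- The exclusion `G ∘ v`: delete `v` and add an arc `(p, s)` for every predecessor `p`
and successor `s` of `v`. -/
def exclude (G : Dgraph V) (v : V) : Dgraph V :=
  deleteVertex G v ∪ Npre G v ×ˢ Nsucc G v

/-- A diclique: all pairs of distinct vertices of `S` are joined by bi-edges. -/
def IsDiclique (G : Dgraph V) (S : Finset V) : Prop :=
  ∀ u ∈ S, ∀ w ∈ S, u ≠ w → (u, w) ∈ G ∧ (w, u) ∈ G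

/-- The arc relation of `G` restricted to the vertices outside `D`. -/
def ArcOff (G : Dgraph V) (D : Finset V) (a b : V) : Prop :=
  (a, b) ∈ G ∧ a ∉ D ∧ b ∉ D

omit [Fintype V] [DecidableEq V] in
theorem isPath_cons_cons {G : Dgraph V} {a b : V} {l : List V} :
    IsPath G (a :: b :: l) ↔ (a, b) ∈ G ∧ IsPath G (b :: l) :=
  List.isChain_cons_cons

omit [Fintype V] [DecidableEq V] in
theorem isPath_singleton (G : Dgraph V) (a : V) : IsPath G [a] :=
  List.isChain_singleton a

omit [Fintype V] [DecidableEq V] in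
theorem transGen_arcOff_of_path (G : Dgraph V) (D : Finset V) (l : List V) :
    ∀ a b c : V, IsPath G (a :: b :: l) → (∀ x ∈ a :: b :: l, x ∉ D) →
      (a :: b :: l).getLast? = some c → Relation.TransGen (ArcOff G D) a c := by
  induction l with
  | nil =>
    intro a b c hp hD hc
    obtain rfl : b = c := by simpa using hc
    exact .single ⟨(isPath_cons_cons.1 hp).1, hD a (by simp), hD b (by simp)⟩
  | cons d l ih =>
    intro a b c hp hD hc
    have hp' := isPath_cons_cons.1 hp
    exact .head ⟨hp'.1, hD a (by simp), hD b (by simp)⟩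
      (ih b d c hp'.2 (fun x hx => hD x (List.mem_cons_of_mem _ hx)) (by simpa using hc))

omit [Fintype V] [DecidableEq V] in
theorem exists_path_of_transGen_arcOff (G : Dgraph V) (D : Finset V) {a b : V}
    (h : Relation.TransGen (ArcOff G D) a b) :
    ∃ p : List V, IsPathFrom G a b p ∧ 2 ≤ p.length ∧ ∀ x ∈ p, x ∉ D := by
  induction h using Relation.TransGen.head_induction_on with
  | @single a h =>
    exact ⟨[a, b], ⟨isPath_cons_cons.2 ⟨h.1, isPath_singleton G b⟩, rfl, rfl⟩, by simp,
      by simpa using h.2⟩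
  | @head a c h _ ih =>
    obtain ⟨p, ⟨hp, hh, hl⟩, hlen, hD⟩ := ih
    match p, hp, hh, hl, hlen, hD with
    | x :: y :: l, hp, hh, hl, hlen, hD =>
      obtain rfl : x = c := by simpa using hh
      refine ⟨a :: x :: y :: l, ⟨?_, by simp, by simpa using hl⟩, by simp, ?_⟩
      · exact isPath_cons_cons.2 ⟨h.1, hp⟩
      · intro z hz
        rcases List.mem_cons.1 hz with rfl | hz
        · exact h.2.1
        · exact hD z hz

omit [Fintype V] [DecidableEq V] in
theorem isDFVS_iff_transGen (G : Dgraph V) (D : Finset V) :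
    IsDFVS G D ↔ ∀ a, ¬ Relation.TransGen (ArcOff G D) a a := by
  constructor
  · intro h a ha
    obtain ⟨p, ⟨hp, hh, hl⟩, hlen, hD⟩ := exists_path_of_transGen_arcOff G D ha
    obtain ⟨x, hx, hxD⟩ := h p ⟨hp, hlen, hh.trans hl.symm⟩
    exact hD x hx hxD
  · rintro h p ⟨hp, hlen, hc⟩
    by_contra! hD
    match p, hp, hlen, hc, hD with
    | a :: b :: l, hp, _, hc, hD =>
      exact h a (transGen_arcOff_of_path G D l a b a hp hD (by simpa using hc.symm))

theorem mem_exclude {G : Dgraph V} {v a b : V} :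
    (a, b) ∈ exclude G v ↔
      ((a, b) ∈ G ∧ a ≠ v ∧ b ≠ v) ∨ ((a, v) ∈ G ∧ (v, b) ∈ G) := by
  simp [exclude, deleteVertex, Npre, Nsucc]

theorem transGen_exclude {G : Dgraph V} {v : V} (hloop : (v, v) ∉ G) {D : Finset V} {a b : V}
    (ha : a ≠ v) (h : Relation.TransGen (ArcOff G D) a b) :
    (b ≠ v → Relation.TransGen (ArcOff (exclude G v) D) a b) ∧
      (b = v → ∃ p, (p, v) ∈ G ∧ p ∉ D ∧
        Relation.ReflTransGen (ArcOff (exclude G v) D) a p) := by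
  induction h with
  | @single b h =>
    refine ⟨fun hb => .single ⟨mem_exclude.2 (.inl ⟨h.1, ha, hb⟩), h.2⟩, ?_⟩
    rintro rfl
    exact ⟨a, h.1, h.2.1, .refl⟩
  | @tail b c _ h ih =>
    by_cases hb : b = v
    · obtain ⟨p, hpv, hpD, hap⟩ := ih.2 hb
      subst hb
      refine ⟨fun _ => .tail' hap ⟨mem_exclude.2 (.inr ⟨hpv, h.1⟩), hpD, h.2.2⟩, ?_⟩
      rintro rfl
      exact absurd h.1 hloop
    · refine ⟨fun hc => .tail (ih.1 hb) ⟨mem_exclude.2 (.inl ⟨h.1, hb, hc⟩), h.2⟩, ?_⟩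
      rintro rfl
      exact ⟨b, h.1, h.2.1, (ih.1 hb).to_reflTransGen⟩

theorem IsDFVS.of_exclude {G : Dgraph V} {v : V} (hloop : (v, v) ∉ G) {D : Finset V}
    (h : IsDFVS (exclude G v) D) : IsDFVS G D := by
  rw [isDFVS_iff_transGen] at h ⊢
  have off : ∀ a, a ≠ v → ¬ Relation.TransGen (ArcOff G D) a a := fun a ha hc =>
    h a ((transGen_exclude hloop ha hc).1 ha)
  intro a hc
  by_cases ha : a = v
  · subst ha
    obtain ⟨s, hs, hsa⟩ := Relation.TransGen.head'_iff.1 hc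
    have hne : s ≠ a := by rintro rfl; exact hloop hs.1
    exact off s hne (.tail' hsa hs)
  · exact off a ha hc

theorem IsDFVS.exclude_of_notMem {G : Dgraph V} {v : V} {D : Finset V} (hv : v ∉ D)
    (h : IsDFVS G D) : IsDFVS (exclude G v) D := by
  rw [isDFVS_iff_transGen] at h ⊢
  refine fun a hc => h a (Relation.TransGen.lift' id (fun x y hxy => ?_) _ _ hc)
  rcases mem_exclude.1 hxy.1 with hG | hG
  · exact .single ⟨hG.1, hxy.2⟩
  · exact .head ⟨hG.1, hxy.2.1, hv⟩ (.single ⟨hG.2, hv, hxy.2.2⟩)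

theorem IsDFVS.exclude_erase_union {G : Dgraph V} {v : V} {D : Finset V}
    (h : IsDFVS G D) : IsDFVS (exclude G v) (D.erase v ∪ Nsucc G v) := by
  rw [isDFVS_iff_transGen] at h ⊢
  refine fun a hc => h a (Relation.TransGen.mono (fun x y hxy => ?_) _ _ hc)
  obtain ⟨hE, hx, hy⟩ := hxy
  simp only [Finset.mem_union, Finset.mem_erase, Nsucc, Finset.mem_filter, Finset.mem_univ,
    true_and, not_or, not_and] at hx hy
  rcases mem_exclude.1 hE with hG | hG
  · exact ⟨hG.1, hx.1 hG.2.1, hy.1 hG.2.2⟩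
  · exact absurd hG.2 hy.2

omit [Fintype V] in
theorem card_sdiff_le_one_of_isDiclique {G : Dgraph V} {S D : Finset V} (hS : IsDiclique G S)
    (h : IsDFVS G D) : (S \ D).card ≤ 1 := by
  rw [isDFVS_iff_transGen] at h
  refine Finset.card_le_one.2 fun u hu w hw => ?_
  rw [Finset.mem_sdiff] at hu hw
  by_contra hne
  obtain ⟨huw, hwu⟩ := hS u hu.1 w hw.1 hne
  exact h u (.head ⟨huw, hu.2, hw.2⟩ (.single ⟨hwu, hw.2, hu.2⟩))

theorem exists_isDFVS_exclude_card_le {G : Dgraph V} {v : V} (hloop : (v, v) ∉ G)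
    (hout : IsDiclique G (Nsucc G v)) {D : Finset V} (h : IsDFVS G D) :
    ∃ D', IsDFVS (exclude G v) D' ∧ D'.card ≤ D.card := by
  by_cases hv : v ∈ D
  · refine ⟨_, h.exclude_erase_union, ?_⟩
    have hsub : D.erase v ∪ Nsucc G v ⊆ D.erase v ∪ (Nsucc G v \ D) := by
      intro x hx
      have hxv : x ∈ Nsucc G v → x ≠ v := by
        rintro hs rfl
        exact hloop (by simpa [Nsucc] using hs)
      simp only [Finset.mem_union, Finset.mem_erase, Finset.mem_sdiff] at hx ⊢
      tauto
    have h1 := Finset.card_le_card hsub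
    have h2 := Finset.card_union_le (D.erase v) (Nsucc G v \ D)
    have h3 := card_sdiff_le_one_of_isDiclique hout h
    have h4 := Finset.card_erase_add_one hv
    omega
  · exact ⟨D, h.exclude_of_notMem hv, le_rfl⟩

omit [DecidableEq V] in
theorem exists_isDFVS_card_eq_dfvsNum (G : Dgraph V) :
    ∃ D : Finset V, IsDFVS G D ∧ D.card = dfvsNum G := by
  refine Nat.sInf_mem (s := {n | ∃ D : Finset V, IsDFVS G D ∧ D.card = n})
    ⟨_, Finset.univ, ?_, rfl⟩
  rw [isDFVS_iff_transGen]
  intro a hc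
  obtain ⟨b, hb, _⟩ := Relation.TransGen.head'_iff.1 hc
  exact hb.2.1 (Finset.mem_univ _)

omit [Fintype V] [DecidableEq V] in
theorem dfvsNum_le {G : Dgraph V} {D : Finset V} (h : IsDFVS G D) : dfvsNum G ≤ D.card :=
  Nat.sInf_le ⟨D, h, rfl⟩

/-- soundness of OUTDICLIQUE. -/
theorem outdiclique_sound (G : Dgraph V) (v : V) (hloop : (v, v) ∉ G)
    (hout : IsDiclique G (Nsucc G v)) :
    dfvsNum G = dfvsNum (exclude G v) ∧
      ∀ D : Finset V, IsDFVS (exclude G v) D → IsDFVS G D := by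
  refine ⟨le_antisymm ?_ ?_, fun D h => h.of_exclude hloop⟩
  · obtain ⟨D, hD, hcard⟩ := exists_isDFVS_card_eq_dfvsNum (exclude G v)
    exact hcard ▸ dfvsNum_le (hD.of_exclude hloop)
  · obtain ⟨D, hD, hcard⟩ := exists_isDFVS_card_eq_dfvsNum G
    obtain ⟨D', hD', hle⟩ := exists_isDFVS_exclude_card_le hloop hout hD
    exact (dfvsNum_le hD').trans (hle.trans hcard.le)

end

end DFVSP
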